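/- Let a1, c, mu0, mu1 > 0, b ∈ ℝ, and 0 < σ < 2c/a1. Set E = 4·a1³·mu1⁴·σ − 4·a1²·b·mu1³·σ − a1²·mu0²·mu1² − 4·a1²·mu0·mu1²·σ + 8·a1²·mu1²·σ + 2·a1·b·mu0·mu1 − 4·a1·b·mu1·σ − 4·a1·mu0·σ + 4·a1·σ − b², and assume E·(c − a1·σ) > 0. Define B = (a1·mu0·mu1 − b)/(2·a1·σ·(a1·mu1² + 1)), ω = −((a1·mu1²·σ − b·mu1 − mu0 + σ)·mu1)/(a1·mu1² + 1), λ = √(E/(−16·a1·σ·(a1·mu1² + 1)²·(a1·σ − c))), d0 = √(2c − a1·σ)·E/(4·√(a1·σ)·(a1·mu1² + 1)²·(a1·σ − c)), d2 = −3·√(2c − a1·σ)·E/(8·√(a1·σ)·(a1·mu1² + 1)²·(a1·σ − c)), h2 = −3·E/(8·(a1·mu1² + 1)²·(a1·σ − c)), and h0 = (4·a1⁴·mu1⁴·σ³ − 4·a1³·c·mu1⁴·σ² − 4·a1³·b·mu1³·σ² − a1³·mu0²·mu1²·σ − 4·a1³·mu0·mu1²·σ² + 8·a1³·mu1²·σ³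 + 4·a1²·b·c·mu1³·σ + a1²·c·mu0²·mu1² + 4·a1²·c·mu0·mu1²·σ − 8·a1²·c·mu1²·σ² + 2·a1²·b·mu0·mu1·σ − 4·a1²·b·mu1·σ² − 4·a1²·mu0·σ² + 4·a1²·σ³ − 2·a1·b·c·mu0·mu1 + 4·a1·b·c·mu1·σ − a1·b²·σ + 4·a1·c·mu0·σ − 4·a1·c·σ² + b²·c)/(4·a1·σ·(a1·mu1² + 1)²·(a1·σ − c)). Then f(ξ) = d0 + d2·sech²(λ·ξ) and g(ξ) = h0 + h2·sech²(λ·ξ) satisfy the Schrödinger BBM–KdV associated ODE system with parameters a1, c, mu0, mu1, b, wave speed σ, and phase shifts B, ω. -/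

import Mathlib

/-- Derivatives of `p + q * sech²(l x)` expressed through `T = tanh (l x)`. -/
lemma sech_sq_derivs (l p q : ℝ) (f : ℝ → ℝ)
    (hf : ∀ x : ℝ, f x = p + q * (1/Real.cosh (l*x))^2) (x : ℝ) :
    ∃ T : ℝ, T = Real.tanh (l*x) ∧ f x = p + q * (1 - T^2) ∧
      deriv f x = q * (-2*l*T*(1-T^2)) ∧
      iteratedDeriv 2 f x = q * (-2*l^2*(1-T^2)*(1-3*T^2)) ∧
      iteratedDeriv 3 f x = q * (l^3*(1-T^2)*(16*T-24*T^3)) := by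
  have hT : ∀ y : ℝ, HasDerivAt (fun x => Real.tanh (l*x)) (l * (1 - Real.tanh (l*y)^2)) y := by
    intro y
    have h0 : HasDerivAt (fun x : ℝ => l*x) l y := by
      simpa using (hasDerivAt_id y).const_mul l
    have hc : Real.cosh (l*y) ≠ 0 := (Real.cosh_pos _).ne'
    have h1 := (h0.sinh).div (h0.cosh) hc
    have h2 : (fun x => Real.tanh (l*x)) = (fun x => Real.sinh (l*x)) / fun x => Real.cosh (l*x) := by
      funext z
      simp [Real.tanh_eq_sinh_div_cosh]
    rw [h2]
    refine HasDerivAt.congr_deriv h1 ?_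
    rw [Real.tanh_eq_sinh_div_cosh]
    field_simp
  have hf' : f = fun x => p + q * (1 - Real.tanh (l*x)^2) := by
    funext y
    rw [hf]
    have hc : Real.cosh (l*y) ≠ 0 := (Real.cosh_pos _).ne'
    have h3 := Real.cosh_sq_sub_sinh_sq (l*y)
    rw [Real.tanh_eq_sinh_div_cosh]
    field_simp
    linear_combination (-q) * h3
  have d1 : deriv f = fun x => q * (-2*l*Real.tanh (l*x)*(1-Real.tanh (l*x)^2)) := by
    funext y
    rw [hf']
    have h := ((((hT y).pow 2).const_sub 1).const_mul q).const_add p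
    refine (HasDerivAt.congr_deriv h ?_).deriv
    push_cast
    ring
  have d2 : deriv (deriv f) = fun x => q * (-2*l^2*(1-Real.tanh (l*x)^2)*(1-3*Real.tanh (l*x)^2)) := by
    funext y
    rw [d1]
    have h := (((hT y).const_mul (-2*l)).mul (((hT y).pow 2).const_sub 1)).const_mul q
    refine (HasDerivAt.congr_deriv h ?_).deriv
    simp only [Pi.pow_apply]
    push_cast
    ring
  have d3 : deriv (deriv (deriv f)) =
      fun x => q * (l^3*(1-Real.tanh (l*x)^2)*(16*Real.tanh (l*x)-24*Real.tanh (l*x)^3)) := by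
    funext y
    rw [d2]
    have h := (((((hT y).pow 2).const_sub 1).const_mul (-2*l^2)).mul
      ((((hT y).pow 2).const_mul 3).const_sub 1)).const_mul q
    refine (HasDerivAt.congr_deriv h ?_).deriv
    simp only [Pi.pow_apply]
    push_cast
    ring
  refine ⟨_, rfl, by rw [hf'], by rw [d1], ?_, ?_⟩
  · rw [iteratedDeriv_succ, iteratedDeriv_one, d2]
  · rw [iteratedDeriv_succ, iteratedDeriv_succ, iteratedDeriv_one, d3]

theorem stmt_11
    (a1 c mu0 mu1 b : ℝ)
    (ha1 : 0 < a1) (hc : 0 < c) (hmu0 : 0 < mu0) (hmu1 : 0 < mu1)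
    (σ : ℝ) (hσ : 0 < σ) (hσlt : σ < 2*c/a1)
    (E : ℝ) (hE : E = 4*a1^3*mu1^4*σ - 4*a1^2*b*mu1^3*σ - a1^2*mu0^2*mu1^2 - 4*a1^2*mu0*mu1^2*σ + 8*a1^2*mu1^2*σ + 2*a1*b*mu0*mu1 - 4*a1*b*mu1*σ - 4*a1*mu0*σ + 4*a1*σ - b^2) (hEsgn : E * (c - a1*σ) > 0)
    (B ω lam d0 d2 h2 h0 : ℝ)
    (h_B : B = (a1*mu0*mu1 - b)/(2*a1*σ*(a1*mu1^2 + 1)))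
    (h_ω : ω = -((a1*mu1^2*σ - b*mu1 - mu0 + σ)*mu1)/(a1*mu1^2 + 1))
    (h_lam : lam = Real.sqrt (E/(-16*a1*σ*(a1*mu1^2 + 1)^2*(a1*σ - c))))
    (h_d0 : d0 = Real.sqrt (2*c - a1*σ)*E/(4*Real.sqrt (a1*σ)*(a1*mu1^2 + 1)^2*(a1*σ - c)))
    (h_d2 : d2 = -3*Real.sqrt (2*c - a1*σ)*E/(8*Real.sqrt (a1*σ)*(a1*mu1^2 + 1)^2*(a1*σ - c)))
    (h_h2 : h2 = -3*E/(8*(a1*mu1^2 + 1)^2*(a1*σ - c)))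
    (h_h0 : h0 = (4*a1^4*mu1^4*σ^3 - 4*a1^3*c*mu1^4*σ^2 - 4*a1^3*b*mu1^3*σ^2 - a1^3*mu0^2*mu1^2*σ - 4*a1^3*mu0*mu1^2*σ^2 + 8*a1^3*mu1^2*σ^3 + 4*a1^2*b*c*mu1^3*σ + a1^2*c*mu0^2*mu1^2 + 4*a1^2*c*mu0*mu1^2*σ - 8*a1^2*c*mu1^2*σ^2 + 2*a1^2*b*mu0*mu1*σ - 4*a1^2*b*mu1*σ^2 - 4*a1^2*mu0*σ^2 + 4*a1^2*σ^3 - 2*a1*b*c*mu0*mu1 + 4*a1*b*c*mu1*σ - a1*b^2*σ + 4*a1*c*mu0*σ - 4*a1*c*σ^2 + b^2*c)/(4*a1*σ*(a1*mu1^2 + 1)^2*(a1*σ - c)))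
    (f g : ℝ → ℝ)
    (hfdef : ∀ ξ : ℝ, f ξ = d0 + d2 * (1/Real.cosh (lam*ξ))^2)
    (hgdef : ∀ ξ : ℝ, g ξ = h0 + h2 * (1/Real.cosh (lam*ξ))^2) :
    ∀ ξ : ℝ,
      (deriv f ξ * g ξ + f ξ * deriv g ξ + a1*σ * iteratedDeriv 3 f ξ + (mu0 + 2*a1*B*ω - 3*a1*B^2*σ - σ - 2*b*B) * deriv f ξ = 0) ∧
      ((B + mu1) * f ξ * g ξ + (3*a1*B*σ + b - a1*ω) * iteratedDeriv 2 f ξ + (ω + B*mu0 + a1*B^2*ω - a1*B^3*σ - B*σ - b*B^2) * f ξ = 0) ∧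
      (f ξ * deriv f ξ + g ξ * deriv g ξ + c * iteratedDeriv 3 g ξ + (1 - σ) * deriv g ξ = 0) := by
  intro ξ
  obtain ⟨T, hT, f0, f1, f2, f3⟩ := sech_sq_derivs lam d0 d2 f hfdef ξ
  obtain ⟨T', hT', g0, g1, -, g3⟩ := sech_sq_derivs lam h0 h2 g hgdef ξ
  obtain rfl : T = T' := hT.trans hT'.symm
  have hD : 0 < a1*mu1^2 + 1 := by positivity
  have hD0 := hD.ne'
  have hσ0 := hσ.ne'
  have ha0 := ha1.ne'
  have has : 0 < a1*σ := by positivity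
  have hne : a1*σ - c ≠ 0 := by
    intro h
    have h' : c - a1*σ = 0 := by linarith
    rw [h'] at hEsgn
    simp at hEsgn
  have h2c : 0 ≤ 2*c - a1*σ := by
    rw [lt_div_iff₀ ha1] at hσlt
    linarith
  have hL : lam^2 = E/(-16*a1*σ*(a1*mu1^2 + 1)^2*(a1*σ - c)) := by
    rw [h_lam, Real.sq_sqrt]
    have e : E/(-16*a1*σ*(a1*mu1^2 + 1)^2*(a1*σ - c))
        = (E * (c - a1*σ))/(16*a1*σ*(a1*mu1^2 + 1)^2*(a1*σ - c)^2) := by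
      field_simp
      ring
    rw [e]
    positivity
  have r1 : h2 = 6*(a1*σ)*lam^2 := by
    rw [hL, h_h2]
    field_simp
    ring
  have r2 : d0 = -(2/3)*d2 := by
    rw [h_d0, h_d2]
    have := (Real.sqrt_pos.2 has).ne'
    field_simp
    ring
  have r3 : d2^2 = 12*c*lam^2*h2 - h2^2 := by
    have e : d2 = Real.sqrt (2*c - a1*σ) / Real.sqrt (a1*σ) * h2 := by
      rw [h_d2, h_h2]
      have := (Real.sqrt_pos.2 has).ne'
      field_simp
    rw [e, mul_pow, div_pow, Real.sq_sqrt h2c, Real.sq_sqrt has.le, r1]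
    field_simp
    ring
  have r4 : h0 = E/(4*a1*σ*(a1*mu1^2+1)^2) + σ - 1 := by
    rw [h_h0, hE]
    field_simp
    ring
  have r5 : h0 = 4*c*lam^2 - 4*a1*σ*lam^2 + σ - 1 := by
    rw [r4, hL]
    field_simp
    ring
  have r6 : mu0 + 2*a1*B*ω - 3*a1*B^2*σ - σ - 2*b*B = -h0 := by
    rw [r4, hE, h_B, h_ω]
    field_simp
    ring
  have r7 : 3*a1*B*σ + b - a1*ω = (B + mu1)*(a1*σ) := by
    rw [h_B, h_ω]
    field_simp
    ring
  have r8 : ω + B*mu0 + a1*B^2*ω - a1*B^3*σ - B*σ - b*B^2 = -(B + mu1)*h0 := by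
    rw [r4, hE, h_B, h_ω]
    field_simp
    ring
  rw [f0, f1, f2, f3, g0, g1, g3, r6, r7, r8]
  clear r4 r6 r7 r8 hL h_h0 h_d0 h_d2 h_h2 h_lam hE h_B h_ω
  refine ⟨?_, ?_, ?_⟩
  · rw [r2, r1]
    ring
  · rw [r2, r1]
    ring
  · rw [r2]
    have r3' : d2^2 = 12*c*lam^2*(6*(a1*σ)*lam^2) - (6*(a1*σ)*lam^2)^2 := by rw [r3, r1]
    rw [r5, r1]
    linear_combination (-2*lam*T*(1-T^2)*(1/3-T^2)) * r3'
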